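/- arXiv:1805.09437 — 13 statements merged into one kernel-verified Lean document; each statement's English description precedes it below -/
import Mathlib

section
/- Soundness of RK: if a hypersequent H is derivable in the relational hypersequent calculus RK, then no Kripke model is a counter-example to H (i.e., H is valid on the class of all Kripke frames). -/
/-- Modal formulas: atoms, negation, conjunction, box. -/
inductive MF : Type
  | atom : ℕ → MF
  | neg : MF → MF
  | conj : MF → MF → MF
  | box : MF → MF

/-- A sequent: a pair of finite multisets of modal formulas. -/
structure Seqt : Type where
  ant : Multiset MF
  suc : Multiset MF

/-- The empty sequent. -/
def Seqt.empty : Seqt := ⟨0, 0⟩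

/-- A hypersequent: a (nonempty, enforced in theorems) sequence of sequents. -/
abbrev Hyperseq := List Seqt

/-- A Kripke model. -/
structure KModel : Type 1 where
  W : Type
  R : W → W → Prop
  V : ℕ → W → Prop

/-- Satisfaction of a modal formula at a world. -/
def KModel.sat (M : KModel) : M.W → MF → Prop
  | w, .atom n => M.V n w
  | w, .neg φ => ¬ M.sat w φ
  | w, .conj φ ψ => M.sat w φ ∧ M.sat w ψ
  | w, .box φ => ∀ v, M.R w v → M.sat v φ

/-- `M` is a countermodel to sequent `S` at world `w`. -/
def Countermodel (M : KModel) (w : M.W) (S : Seqt) : Prop :=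
  (∀ φ ∈ S.ant, M.sat w φ) ∧ (∀ φ ∈ S.suc, ¬ M.sat w φ)

/-- `M` is a counter-example to hypersequent `H`: there is a branch of worlds
(consecutive worlds related by `R`) falsifying the components pointwise. -/
def CounterExample (M : KModel) (H : Hyperseq) : Prop :=
  ∃ ws : List M.W, List.Chain' M.R ws ∧
    List.Forall₂ (fun S w => Countermodel M w S) H ws

/-- Which optional rules are present in a calculus (RK rules are always present). -/
structure RuleSet : Type where
  cut : Bool := false
  ec : Bool := false
  ew : Bool := false
  ee : Bool := false
  drop : Bool := false
  sym : Bool := false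

/-- Derivability in a relational hypersequent calculus: the rules of RK
(axioms, internal weakening/contraction, EWL/EWR, rules for ¬, ∧, □),
plus cut and the external structural rules EC, EW, EE, Drop, Sym when enabled. -/
inductive Deriv (ρ : RuleSet) : Hyperseq → Prop
  | ax (φ : MF) : Deriv ρ [⟨{φ}, {φ}⟩]
  | wl (G H : Hyperseq) (Γ Δ : Multiset MF) (φ : MF) :
      Deriv ρ (G ++ ⟨Γ, Δ⟩ :: H) → Deriv ρ (G ++ ⟨φ ::ₘ Γ, Δ⟩ :: H)
  | wr (G H : Hyperseq) (Γ Δ : Multiset MF) (φ : MF) :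
      Deriv ρ (G ++ ⟨Γ, Δ⟩ :: H) → Deriv ρ (G ++ ⟨Γ, φ ::ₘ Δ⟩ :: H)
  | cl (G H : Hyperseq) (Γ Δ : Multiset MF) (φ : MF) :
      Deriv ρ (G ++ ⟨φ ::ₘ φ ::ₘ Γ, Δ⟩ :: H) → Deriv ρ (G ++ ⟨φ ::ₘ Γ, Δ⟩ :: H)
  | cr (G H : Hyperseq) (Γ Δ : Multiset MF) (φ : MF) :
      Deriv ρ (G ++ ⟨Γ, φ ::ₘ φ ::ₘ Δ⟩ :: H) → Deriv ρ (G ++ ⟨Γ, φ ::ₘ Δ⟩ :: H)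
  | cut (hρ : ρ.cut = true) (G H : Hyperseq) (Γ Δ Λ Θ : Multiset MF) (φ : MF) :
      Deriv ρ (G ++ ⟨Γ, φ ::ₘ Δ⟩ :: H) → Deriv ρ (G ++ ⟨φ ::ₘ Λ, Θ⟩ :: H) →
      Deriv ρ (G ++ ⟨Γ + Λ, Δ + Θ⟩ :: H)
  | ewr (G : Hyperseq) : Deriv ρ G → Deriv ρ (G ++ [Seqt.empty])
  | ewl (G : Hyperseq) : Deriv ρ G → Deriv ρ (Seqt.empty :: G)
  | negL (G H : Hyperseq) (Γ Δ : Multiset MF) (φ : MF) :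
      Deriv ρ (G ++ ⟨Γ, φ ::ₘ Δ⟩ :: H) → Deriv ρ (G ++ ⟨.neg φ ::ₘ Γ, Δ⟩ :: H)
  | negR (G H : Hyperseq) (Γ Δ : Multiset MF) (φ : MF) :
      Deriv ρ (G ++ ⟨φ ::ₘ Γ, Δ⟩ :: H) → Deriv ρ (G ++ ⟨Γ, .neg φ ::ₘ Δ⟩ :: H)
  | andL1 (G H : Hyperseq) (Γ Δ : Multiset MF) (φ ψ : MF) :
      Deriv ρ (G ++ ⟨φ ::ₘ Γ, Δ⟩ :: H) → Deriv ρ (G ++ ⟨.conj φ ψ ::ₘ Γ, Δ⟩ :: H)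
  | andL2 (G H : Hyperseq) (Γ Δ : Multiset MF) (φ ψ : MF) :
      Deriv ρ (G ++ ⟨ψ ::ₘ Γ, Δ⟩ :: H) → Deriv ρ (G ++ ⟨.conj φ ψ ::ₘ Γ, Δ⟩ :: H)
  | andR (G H : Hyperseq) (Γ Δ : Multiset MF) (φ ψ : MF) :
      Deriv ρ (G ++ ⟨Γ, φ ::ₘ Δ⟩ :: H) → Deriv ρ (G ++ ⟨Γ, ψ ::ₘ Δ⟩ :: H) →
      Deriv ρ (G ++ ⟨Γ, .conj φ ψ ::ₘ Δ⟩ :: H)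
  | boxL (G H : Hyperseq) (Γ Δ Λ Θ : Multiset MF) (φ : MF) :
      Deriv ρ (G ++ ⟨Γ, Δ⟩ :: ⟨φ ::ₘ Λ, Θ⟩ :: H) →
      Deriv ρ (G ++ ⟨.box φ ::ₘ Γ, Δ⟩ :: ⟨Λ, Θ⟩ :: H)
  | boxR (G : Hyperseq) (Γ Δ : Multiset MF) (φ : MF) :
      Deriv ρ (G ++ [⟨Γ, Δ⟩, ⟨0, {φ}⟩]) → Deriv ρ (G ++ [⟨Γ, .box φ ::ₘ Δ⟩])
  | ec (hρ : ρ.ec = true) (G H : Hyperseq) (S : Seqt) :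
      Deriv ρ (G ++ S :: S :: H) → Deriv ρ (G ++ S :: H)
  | ew (hρ : ρ.ew = true) (G H : Hyperseq) :
      Deriv ρ (G ++ H) → Deriv ρ (G ++ Seqt.empty :: H)
  | ee (hρ : ρ.ee = true) (G H : Hyperseq) (S S' : Seqt) :
      Deriv ρ (G ++ S :: S' :: H) → Deriv ρ (G ++ S' :: S :: H)
  | drop (hρ : ρ.drop = true) (G : Hyperseq) :
      Deriv ρ (G ++ [Seqt.empty]) → Deriv ρ G
  | symm (hρ : ρ.sym = true) (G : Hyperseq) : Deriv ρ G → Deriv ρ G.reverse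

/-- The calculus RK (with cut). -/
def RK : RuleSet := { cut := true }

theorem countermodel_cons_ant {M : KModel} {w : M.W} {φ : MF} {Γ Δ : Multiset MF} :
    Countermodel M w ⟨φ ::ₘ Γ, Δ⟩ ↔ M.sat w φ ∧ Countermodel M w ⟨Γ, Δ⟩ := by
  simp [Countermodel, and_assoc]

theorem countermodel_cons_suc {M : KModel} {w : M.W} {φ : MF} {Γ Δ : Multiset MF} :
    Countermodel M w ⟨Γ, φ ::ₘ Δ⟩ ↔ ¬ M.sat w φ ∧ Countermodel M w ⟨Γ, Δ⟩ := by
  simp [Countermodel, and_left_comm]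

theorem countermodel_add {M : KModel} {w : M.W} {Γ Δ Λ Θ : Multiset MF} :
    Countermodel M w ⟨Γ + Λ, Δ + Θ⟩ ↔
      Countermodel M w ⟨Γ, Δ⟩ ∧ Countermodel M w ⟨Λ, Θ⟩ := by
  simp only [Countermodel, Multiset.mem_add, or_imp, forall_and]
  tauto

theorem countermodel_empty (M : KModel) (w : M.W) : Countermodel M w Seqt.empty := by
  simp [Countermodel, Seqt.empty]

/-- A counter-example to `G ++ K` splits into branches falsifying `G` and `K` whose
concatenation is a branch. -/
theorem counterExample_append {M : KModel} {G K : Hyperseq} :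
    CounterExample M (G ++ K) ↔ ∃ us vs : List M.W, List.IsChain M.R (us ++ vs) ∧
      List.Forall₂ (fun S w => Countermodel M w S) G us ∧
      List.Forall₂ (fun S w => Countermodel M w S) K vs := by
  constructor
  · rintro ⟨ws, hc, h⟩
    refine ⟨ws.take G.length, ws.drop G.length, by rwa [List.take_append_drop], ?_, ?_⟩
    · simpa using List.forall₂_take G.length h
    · simpa using List.forall₂_drop G.length h
  · rintro ⟨us, vs, hc, hG, hK⟩
    exact ⟨us ++ vs, hc, List.rel_append hG hK⟩

/-- The world falsifying one component of a counter-example; that component may be replaced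
by any other sequent falsified there. -/
theorem CounterExample.exists_world {M : KModel} {G H : Hyperseq} {S : Seqt}
    (h : CounterExample M (G ++ S :: H)) :
    ∃ w, Countermodel M w S ∧
      ∀ T, Countermodel M w T → CounterExample M (G ++ T :: H) := by
  obtain ⟨us, vs, hc, hG, hK⟩ := counterExample_append.1 h
  cases hK with
  | cons hS hH =>
    exact ⟨_, hS, fun T hT => counterExample_append.2 ⟨us, _, hc, hG, .cons hT hH⟩⟩

/-- Soundness of RK: derivable hypersequents have no counter-example in any Kripke model. -/
theorem RK_soundness (H : Hyperseq) (hH : Deriv RK H) (M : KModel) :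
    ¬ CounterExample M H := by
  induction hH with
  | ax φ =>
    rintro ⟨ws, -, h⟩
    cases h with
    | cons h _ => exact h.2 φ (by simp) (h.1 φ (by simp))
  | wl G H Γ Δ φ _ ih =>
    intro h
    obtain ⟨w, hw, k⟩ := h.exists_world
    exact ih (k _ (countermodel_cons_ant.1 hw).2)
  | wr G H Γ Δ φ _ ih =>
    intro h
    obtain ⟨w, hw, k⟩ := h.exists_world
    exact ih (k _ (countermodel_cons_suc.1 hw).2)
  | cl G H Γ Δ φ _ ih =>
    intro h
    obtain ⟨w, hw, k⟩ := h.exists_world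
    exact ih (k _ (countermodel_cons_ant.2 ⟨(countermodel_cons_ant.1 hw).1, hw⟩))
  | cr G H Γ Δ φ _ ih =>
    intro h
    obtain ⟨w, hw, k⟩ := h.exists_world
    exact ih (k _ (countermodel_cons_suc.2 ⟨(countermodel_cons_suc.1 hw).1, hw⟩))
  | cut _ G H Γ Δ Λ Θ φ _ _ ih₁ ih₂ =>
    intro h
    obtain ⟨w, hw, k⟩ := h.exists_world
    obtain ⟨hl, hr⟩ := countermodel_add.1 hw
    by_cases hφ : M.sat w φ
    · exact ih₂ (k _ (countermodel_cons_ant.2 ⟨hφ, hr⟩))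
    · exact ih₁ (k _ (countermodel_cons_suc.2 ⟨hφ, hl⟩))
  | ewr G _ ih =>
    intro h
    obtain ⟨us, vs, hc, hG, -⟩ := counterExample_append.1 h
    exact ih ⟨us, hc.left_of_append, hG⟩
  | ewl G _ ih =>
    rintro ⟨ws, hc, h⟩
    cases h with
    | cons _ hG => exact ih ⟨_, hc.tail, hG⟩
  | negL G H Γ Δ φ _ ih =>
    intro h
    obtain ⟨w, hw, k⟩ := h.exists_world
    exact ih (k _ (countermodel_cons_suc.2 (countermodel_cons_ant.1 hw)))
  | negR G H Γ Δ φ _ ih =>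
    intro h
    obtain ⟨w, hw, k⟩ := h.exists_world
    obtain ⟨hφ, hw⟩ := countermodel_cons_suc.1 hw
    exact ih (k _ (countermodel_cons_ant.2 ⟨not_not.1 hφ, hw⟩))
  | andL1 G H Γ Δ φ ψ _ ih =>
    intro h
    obtain ⟨w, hw, k⟩ := h.exists_world
    obtain ⟨hφψ, hw⟩ := countermodel_cons_ant.1 hw
    exact ih (k _ (countermodel_cons_ant.2 ⟨hφψ.1, hw⟩))
  | andL2 G H Γ Δ φ ψ _ ih =>
    intro h
    obtain ⟨w, hw, k⟩ := h.exists_world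
    obtain ⟨hφψ, hw⟩ := countermodel_cons_ant.1 hw
    exact ih (k _ (countermodel_cons_ant.2 ⟨hφψ.2, hw⟩))
  | andR G H Γ Δ φ ψ _ _ ih₁ ih₂ =>
    intro h
    obtain ⟨w, hw, k⟩ := h.exists_world
    obtain ⟨hφψ, hw⟩ := countermodel_cons_suc.1 hw
    by_cases hφ : M.sat w φ
    · exact ih₂ (k _ (countermodel_cons_suc.2 ⟨fun hψ => hφψ ⟨hφ, hψ⟩, hw⟩))
    · exact ih₁ (k _ (countermodel_cons_suc.2 ⟨hφ, hw⟩))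
  | boxL G H Γ Δ Λ Θ φ _ ih =>
    intro h
    obtain ⟨us, vs, hc, hG, hK⟩ := counterExample_append.1 h
    cases hK with
    | cons hS hK =>
      cases hK with
      | cons hT hH =>
        obtain ⟨hbox, hS⟩ := countermodel_cons_ant.1 hS
        have hR := (List.isChain_cons_cons.1 hc.right_of_append).1
        exact ih (counterExample_append.2 ⟨us, _, hc, hG,
          .cons hS (.cons (countermodel_cons_ant.2 ⟨hbox _ hR, hT⟩) hH)⟩)
  | boxR G Γ Δ φ _ ih =>
    intro h
    obtain ⟨us, vs, hc, hG, hK⟩ := counterExample_append.1 h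
    cases hK with
    | @cons _ w _ _ hS hK =>
      cases hK
      obtain ⟨hbox, hS⟩ := countermodel_cons_suc.1 hS
      obtain ⟨v, hR, hv⟩ : ∃ v, M.R w v ∧ ¬ M.sat v φ := by
        simpa [KModel.sat] using hbox
      refine ih (counterExample_append.2 ⟨us, [w, v], ?_, hG, .cons hS (.cons ?_ .nil)⟩)
      · exact List.isChain_split.2 ⟨hc, List.isChain_pair.2 hR⟩
      · exact countermodel_cons_suc.2 ⟨hv, countermodel_empty M v⟩
  | ec hρ => cases hρ
  | ew hρ => cases hρ
  | ee hρ => cases hρ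
  | drop hρ => cases hρ
  | symm hρ => cases hρ
end

section
/- Soundness of RB: if a hypersequent H is derivable in the calculus RB (RK extended with the rule Sym), then no Kripke model whose accessibility relation is symmetric is a counter-example to H. -/
/-- The calculus RB = RK + Sym (with cut). -/
def RB : RuleSet := { cut := true, sym := true }

namespace Countermodel

variable {M : KModel} {w : M.W} {Γ Δ Λ Θ : Multiset MF} {φ : MF}

theorem cons_ant_iff :
    Countermodel M w ⟨φ ::ₘ Γ, Δ⟩ ↔ M.sat w φ ∧ Countermodel M w ⟨Γ, Δ⟩ := by
  simp [Countermodel, and_assoc]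

theorem cons_suc_iff :
    Countermodel M w ⟨Γ, φ ::ₘ Δ⟩ ↔ ¬ M.sat w φ ∧ Countermodel M w ⟨Γ, Δ⟩ := by
  simp [Countermodel, and_left_comm]

theorem add_iff :
    Countermodel M w ⟨Γ + Λ, Δ + Θ⟩ ↔ Countermodel M w ⟨Γ, Δ⟩ ∧ Countermodel M w ⟨Λ, Θ⟩ := by
  simp only [Countermodel, Multiset.mem_add, or_imp, forall_and]
  exact and_and_and_comm

end Countermodel

namespace CounterExample

variable {M : KModel} {G H : Hyperseq} {S S' : Seqt}

theorem append_iff :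
    CounterExample M (G ++ H) ↔ ∃ us vs : List M.W, (us ++ vs).IsChain M.R ∧
      List.Forall₂ (fun S w => Countermodel M w S) G us ∧
      List.Forall₂ (fun S w => Countermodel M w S) H vs := by
  constructor
  · rintro ⟨ws, hc, hf⟩
    refine ⟨ws.take G.length, ws.drop G.length, ?_, ?_, ?_⟩
    · rwa [List.take_append_drop]
    · exact List.forall₂_take_append ws G H hf.flip |>.flip
    · exact List.forall₂_drop_append ws G H hf.flip |>.flip
  · rintro ⟨us, vs, hc, hG, hH⟩
    exact ⟨us ++ vs, hc, List.rel_append hG hH⟩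

theorem of_append_left (h : CounterExample M (G ++ H)) : CounterExample M G := by
  obtain ⟨us, vs, hc, hG, -⟩ := append_iff.1 h
  exact ⟨us, hc.left_of_append, hG⟩

theorem of_append_right (h : CounterExample M (G ++ H)) : CounterExample M H := by
  obtain ⟨us, vs, hc, -, hH⟩ := append_iff.1 h
  exact ⟨vs, hc.right_of_append, hH⟩

theorem exists_replace (h : CounterExample M (G ++ S :: H)) :
    ∃ w, Countermodel M w S ∧
      ∀ T, Countermodel M w T → CounterExample M (G ++ T :: H) := by
  obtain ⟨us, _, hc, hG, hS⟩ := append_iff.1 h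
  cases hS with
  | cons hw hH => exact ⟨_, hw, fun T hT => append_iff.2 ⟨us, _, hc, hG, .cons hT hH⟩⟩

theorem exists_replace_pair (h : CounterExample M (G ++ S :: S' :: H)) :
    ∃ w v, M.R w v ∧ Countermodel M w S ∧ Countermodel M v S' ∧
      ∀ T T', Countermodel M w T → Countermodel M v T' →
        CounterExample M (G ++ T :: T' :: H) := by
  obtain ⟨us, _, hc, hG, hS⟩ := append_iff.1 h
  rcases hS with _ | ⟨hw, _ | ⟨hv, hH⟩⟩
  exact ⟨_, _, (List.isChain_cons_cons.1 hc.right_of_append).1, hw, hv,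
    fun T T' hT hT' => append_iff.2 ⟨us, _, hc, hG, .cons hT (.cons hT' hH)⟩⟩

theorem exists_replace_last (h : CounterExample M (G ++ [S])) :
    ∃ w, Countermodel M w S ∧
      ∀ T T' v, M.R w v → Countermodel M w T → Countermodel M v T' →
        CounterExample M (G ++ [T, T']) := by
  obtain ⟨us, _, hc, hG, hS⟩ := append_iff.1 h
  rcases hS with _ | ⟨hw, _ | _⟩
  refine ⟨_, hw, fun T T' v hR hT hT' => append_iff.2
    ⟨us, _, ?_, hG, .cons hT (.cons hT' .nil)⟩⟩
  exact List.isChain_append_cons_cons.2 ⟨hc, hR, .singleton _⟩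

theorem of_reverse (hsym : Symmetric M.R) (h : CounterExample M G.reverse) :
    CounterExample M G := by
  obtain ⟨ws, hc, hf⟩ := h
  refine ⟨ws.reverse, List.isChain_reverse.2 (hc.imp fun _ _ hR => hsym hR), ?_⟩
  simpa using List.rel_reverse hf

end CounterExample

open Countermodel CounterExample in
/-- Soundness of RB: derivable hypersequents have no counter-example in any
Kripke model with symmetric accessibility relation. -/
theorem RB_soundness (H : Hyperseq) (hH : Deriv RB H) (M : KModel)
    (hsym : Symmetric M.R) : ¬ CounterExample M H := by
  induction hH with
  | ax φ =>
    intro h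
    obtain ⟨w, hw, -⟩ := exists_replace (G := []) h
    exact hw.2 φ (Multiset.mem_singleton_self φ) (hw.1 φ (Multiset.mem_singleton_self φ))
  | wl G H Γ Δ φ _ ih =>
    intro h
    obtain ⟨w, hw, hr⟩ := h.exists_replace
    exact ih (hr _ (cons_ant_iff.1 hw).2)
  | wr G H Γ Δ φ _ ih =>
    intro h
    obtain ⟨w, hw, hr⟩ := h.exists_replace
    exact ih (hr _ (cons_suc_iff.1 hw).2)
  | cl G H Γ Δ φ _ ih =>
    intro h
    obtain ⟨w, hw, hr⟩ := h.exists_replace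
    exact ih (hr _ (cons_ant_iff.2 ⟨(cons_ant_iff.1 hw).1, hw⟩))
  | cr G H Γ Δ φ _ ih =>
    intro h
    obtain ⟨w, hw, hr⟩ := h.exists_replace
    exact ih (hr _ (cons_suc_iff.2 ⟨(cons_suc_iff.1 hw).1, hw⟩))
  | cut _ G H Γ Δ Λ Θ φ _ _ ih₁ ih₂ =>
    intro h
    obtain ⟨w, hw, hr⟩ := h.exists_replace
    obtain ⟨hw₁, hw₂⟩ := add_iff.1 hw
    by_cases hφ : M.sat w φ
    · exact ih₂ (hr _ (cons_ant_iff.2 ⟨hφ, hw₂⟩))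
    · exact ih₁ (hr _ (cons_suc_iff.2 ⟨hφ, hw₁⟩))
  | ewr G _ ih => exact fun h => ih h.of_append_left
  | ewl G _ ih => exact fun h => ih (of_append_right (G := [Seqt.empty]) h)
  | negL G H Γ Δ φ _ ih =>
    intro h
    obtain ⟨w, hw, hr⟩ := h.exists_replace
    exact ih (hr _ (cons_suc_iff.2 (cons_ant_iff.1 hw)))
  | negR G H Γ Δ φ _ ih =>
    intro h
    obtain ⟨w, hw, hr⟩ := h.exists_replace
    obtain ⟨hφ, hw⟩ := cons_suc_iff.1 hw
    exact ih (hr _ (cons_ant_iff.2 ⟨not_not.1 hφ, hw⟩))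
  | andL1 G H Γ Δ φ ψ _ ih =>
    intro h
    obtain ⟨w, hw, hr⟩ := h.exists_replace
    obtain ⟨hφ, hw⟩ := cons_ant_iff.1 hw
    exact ih (hr _ (cons_ant_iff.2 ⟨hφ.1, hw⟩))
  | andL2 G H Γ Δ φ ψ _ ih =>
    intro h
    obtain ⟨w, hw, hr⟩ := h.exists_replace
    obtain ⟨hφ, hw⟩ := cons_ant_iff.1 hw
    exact ih (hr _ (cons_ant_iff.2 ⟨hφ.2, hw⟩))
  | andR G H Γ Δ φ ψ _ _ ih₁ ih₂ =>
    intro h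
    obtain ⟨w, hw, hr⟩ := h.exists_replace
    obtain ⟨hφψ, hw⟩ := cons_suc_iff.1 hw
    by_cases hφ : M.sat w φ
    · exact ih₂ (hr _ (cons_suc_iff.2 ⟨fun hψ => hφψ ⟨hφ, hψ⟩, hw⟩))
    · exact ih₁ (hr _ (cons_suc_iff.2 ⟨hφ, hw⟩))
  | boxL G H Γ Δ Λ Θ φ _ ih =>
    intro h
    obtain ⟨w, v, hR, hw, hv, hr⟩ := h.exists_replace_pair
    obtain ⟨hφ, hw⟩ := cons_ant_iff.1 hw
    exact ih (hr _ _ hw (cons_ant_iff.2 ⟨hφ v hR, hv⟩))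
  | boxR G Γ Δ φ _ ih =>
    intro h
    obtain ⟨w, hw, hr⟩ := h.exists_replace_last
    obtain ⟨hφ, hw⟩ := cons_suc_iff.1 hw
    simp only [KModel.sat, not_forall] at hφ
    obtain ⟨v, hR, hv⟩ := hφ
    exact ih (hr _ _ v hR hw (by simpa [Countermodel] using hv))
  | ec hρ => exact absurd hρ Bool.false_ne_true
  | ew hρ => exact absurd hρ Bool.false_ne_true
  | ee hρ => exact absurd hρ Bool.false_ne_true
  | drop hρ => exact absurd hρ Bool.false_ne_true
  | symm _ G _ ih => exact fun h => ih (h.of_reverse hsym)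
end

section
/- Soundness of RD: if a hypersequent H is derivable in the calculus RD (RK extended with the rule Drop), then no Kripke model whose accessibility relation is serial is a counter-example to H. -/
/-- The calculus RD = RK + Drop (with cut). -/
def RD : RuleSet := { cut := true, drop := true }

theorem counterExample_append_iff {M : KModel} {G H : Hyperseq} :
    CounterExample M (G ++ H) ↔ ∃ us vs : List M.W, List.IsChain M.R (us ++ vs) ∧
      List.Forall₂ (fun S w => Countermodel M w S) G us ∧
      List.Forall₂ (fun S w => Countermodel M w S) H vs := by
  constructor
  · rintro ⟨ws, hc, hf⟩
    refine ⟨ws.take G.length, ws.drop G.length, ?_, ?_, ?_⟩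
    · rwa [List.take_append_drop]
    · simpa using List.forall₂_take G.length hf
    · simpa using List.forall₂_drop G.length hf
  · rintro ⟨us, vs, hc, hG, hH⟩
    exact ⟨us ++ vs, hc, List.rel_append hG hH⟩

theorem counterExample_append_cons_iff {M : KModel} {G H : Hyperseq} {S : Seqt} :
    CounterExample M (G ++ S :: H) ↔ ∃ (us : List M.W) (w : M.W) (vs : List M.W),
      List.IsChain M.R (us ++ w :: vs) ∧
      List.Forall₂ (fun S w => Countermodel M w S) G us ∧ Countermodel M w S ∧
      List.Forall₂ (fun S w => Countermodel M w S) H vs := by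
  rw [counterExample_append_iff]
  constructor
  · rintro ⟨us, _, hc, hG, hSH⟩
    cases hSH with
    | cons hS hH => exact ⟨us, _, _, hc, hG, hS, hH⟩
  · rintro ⟨us, w, vs, hc, hG, hS, hH⟩
    exact ⟨us, w :: vs, hc, hG, .cons hS hH⟩

theorem CounterExample.replace_or {M : KModel} {G H : Hyperseq} {S S₁ S₂ : Seqt}
    (h : ∀ w, Countermodel M w S → Countermodel M w S₁ ∨ Countermodel M w S₂)
    (hS : CounterExample M (G ++ S :: H)) :
    CounterExample M (G ++ S₁ :: H) ∨ CounterExample M (G ++ S₂ :: H) := by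
  simp only [counterExample_append_cons_iff] at *
  obtain ⟨us, w, vs, hc, hG, hw, hH⟩ := hS
  exact (h w hw).imp (fun hw => ⟨us, w, vs, hc, hG, hw, hH⟩)
    (fun hw => ⟨us, w, vs, hc, hG, hw, hH⟩)

theorem CounterExample.replace {M : KModel} {G H : Hyperseq} {S S' : Seqt}
    (h : ∀ w, Countermodel M w S → Countermodel M w S')
    (hS : CounterExample M (G ++ S :: H)) : CounterExample M (G ++ S' :: H) :=
  or_self_iff.1 (hS.replace_or fun w hw => .inl (h w hw))

theorem CounterExample.of_append {M : KModel} {G H : Hyperseq}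
    (h : CounterExample M (G ++ H)) : CounterExample M G := by
  obtain ⟨us, vs, hc, hG, -⟩ := counterExample_append_iff.1 h
  exact ⟨us, hc.left_of_append, hG⟩

theorem CounterExample.of_cons {M : KModel} {S : Seqt} {H : Hyperseq}
    (h : CounterExample M (S :: H)) : CounterExample M H := by
  obtain ⟨us, vs, hc, -, hH⟩ := (counterExample_append_iff (G := [S])).1 h
  exact ⟨vs, hc.right_of_append, hH⟩

theorem CounterExample.append_empty {M : KModel} [Nonempty M.W]
    (hser : ∀ w : M.W, ∃ v : M.W, M.R w v) {G : Hyperseq} (h : CounterExample M G) :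
    CounterExample M (G ++ [Seqt.empty]) := by
  obtain ⟨ws, hc, hG⟩ := h
  obtain ⟨v, hv⟩ : ∃ v, List.IsChain M.R (ws ++ [v]) := by
    rcases ws.eq_nil_or_concat with rfl | ⟨us, w, rfl⟩
    · exact ⟨Classical.arbitrary _, by simp⟩
    · obtain ⟨v, hv⟩ := hser w
      refine ⟨v, List.isChain_append.2 ⟨hc, by simp, ?_⟩⟩
      simpa using hv
  exact counterExample_append_iff.2
    ⟨ws, [v], hv, hG, .cons (countermodel_empty M v) .nil⟩

theorem CounterExample.of_boxL {M : KModel} {G H : Hyperseq} {Γ Δ Λ Θ : Multiset MF} {φ : MF}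
    (h : CounterExample M (G ++ ⟨.box φ ::ₘ Γ, Δ⟩ :: ⟨Λ, Θ⟩ :: H)) :
    CounterExample M (G ++ ⟨Γ, Δ⟩ :: ⟨φ ::ₘ Λ, Θ⟩ :: H) := by
  obtain ⟨us, w, _, hc, hG, hw, hT⟩ := counterExample_append_cons_iff.1 h
  cases hT with
  | @cons _ v _ vs hv hH =>
    have hR : M.R w v := (List.isChain_cons_cons.1 hc.right_of_append).1
    refine counterExample_append_cons_iff.2 ⟨us, w, v :: vs, hc, hG, ?_, .cons ?_ hH⟩
    · exact ⟨fun ψ hψ => hw.1 ψ (Multiset.mem_cons_of_mem hψ), hw.2⟩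
    · exact ⟨Multiset.forall_mem_cons.2
        ⟨hw.1 (.box φ) (Multiset.mem_cons_self _ _) v hR, hv.1⟩, hv.2⟩

theorem CounterExample.of_boxR {M : KModel} {G : Hyperseq} {Γ Δ : Multiset MF} {φ : MF}
    (h : CounterExample M (G ++ [⟨Γ, .box φ ::ₘ Δ⟩])) :
    CounterExample M (G ++ [⟨Γ, Δ⟩, ⟨0, {φ}⟩]) := by
  obtain ⟨us, w, _, hc, hG, hw, hT⟩ := counterExample_append_cons_iff.1 h
  cases hT
  obtain ⟨hbox, hΔ⟩ := Multiset.forall_mem_cons.1 hw.2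
  simp only [KModel.sat, not_forall] at hbox
  obtain ⟨v, hR, hv⟩ := hbox
  refine counterExample_append_cons_iff.2
    ⟨us, w, [v], ?_, hG, ⟨hw.1, hΔ⟩, .cons ⟨by simp, by simpa using hv⟩ .nil⟩
  simpa [List.isChain_append, hR] using hc

/-- Nonemptiness is needed so that the empty branch can be extended when `Drop` yields `[]`. -/
theorem Deriv.not_counterExample_of_nonempty {H : Hyperseq} (hH : Deriv RD H) (M : KModel)
    [Nonempty M.W] (hser : ∀ w : M.W, ∃ v : M.W, M.R w v) : ¬ CounterExample M H := by
  induction hH with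
  | ax φ =>
    intro h
    obtain ⟨_, w, _, -, -, hw, -⟩ := (counterExample_append_cons_iff (G := [])).1 h
    exact hw.2 φ (by simp) (hw.1 φ (by simp))
  | cut _ G H Γ Δ Λ Θ φ _ _ ih₁ ih₂ =>
    refine fun h => (h.replace_or fun w hw => ?_).elim ih₁ ih₂
    simp only [Countermodel, Multiset.mem_add, Multiset.mem_cons] at hw ⊢
    by_cases hφ : M.sat w φ <;> grind
  | andR G H Γ Δ φ ψ _ _ ih₁ ih₂ =>
    refine fun h => (h.replace_or fun w hw => ?_).elim ih₁ ih₂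
    simp only [Countermodel, Multiset.forall_mem_cons, KModel.sat] at hw ⊢
    tauto
  | ewr G _ ih => exact fun h => ih h.of_append
  | ewl G _ ih => exact fun h => ih h.of_cons
  | boxL G H Γ Δ Λ Θ φ _ ih => exact fun h => ih h.of_boxL
  | boxR G Γ Δ φ _ ih => exact fun h => ih h.of_boxR
  | drop _ G _ ih => exact fun h => ih (h.append_empty hser)
  | ec hρ | ew hρ | ee hρ | symm hρ => cases hρ
  | wl _ _ _ _ _ _ ih | wr _ _ _ _ _ _ ih | cl _ _ _ _ _ _ ih | cr _ _ _ _ _ _ ih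
  | negL _ _ _ _ _ _ ih | negR _ _ _ _ _ _ ih
  | andL1 _ _ _ _ _ _ _ ih | andL2 _ _ _ _ _ _ _ ih =>
    refine fun h => ih (h.replace fun w hw => ?_)
    simp only [Countermodel, Multiset.forall_mem_cons, KModel.sat] at hw ⊢
    tauto

theorem Deriv.ne_nil {H : Hyperseq} (hH : Deriv RD H) : H ≠ [] := by
  rintro rfl
  have : Nonempty (KModel.mk Unit (fun _ _ => True) (fun _ _ => True)).W := ⟨()⟩
  exact hH.not_counterExample_of_nonempty ⟨Unit, fun _ _ => True, fun _ _ => True⟩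
    (fun _ => ⟨(), trivial⟩) ⟨[], .nil, .nil⟩

/-- Soundness of RD: derivable hypersequents have no counter-example in any
Kripke model with serial accessibility relation. -/
theorem RD_soundness (H : Hyperseq) (hH : Deriv RD H) (M : KModel)
    (hser : ∀ w : M.W, ∃ v : M.W, M.R w v) : ¬ CounterExample M H := by
  rcases isEmpty_or_nonempty M.W with hW | hW
  · rintro ⟨ws, -, hf⟩
    cases hf with
    | nil => exact hH.ne_nil rfl
    | @cons _ w => exact hW.elim w
  · exact hH.not_counterExample_of_nonempty M hser
end

section
/- Soundness of RS5: if a hypersequent H is derivable in the calculus RS5 (RK extended with the rules EC, EW, and EE), then no Kripke model whose accessibility relation is reflexive, transitive, and symmetric is a counter-example to H. -/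
/-- The calculus RS5 = RK + EC + EW + EE (with cut). -/
def RS5 : RuleSet := { cut := true, ec := true, ew := true, ee := true }

/-- A hypersequent derivable in RS5 cannot have all its components falsified inside a set of
pairwise related worlds that is closed under the accessibility relation. -/
theorem Deriv.not_forall_countermodel_of_clique {H : Hyperseq} (hH : Deriv RS5 H) (M : KModel)
    (P : M.W → Prop) (hclique : ∀ u v, P u → P v → M.R u v)
    (hclosed : ∀ u v, P u → M.R u v → P v) :
    ¬ ∀ S ∈ H, ∃ w, P w ∧ Countermodel M w S := by
  induction hH with
  | drop hρ => simp [RS5] at hρ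
  | symm hρ => simp [RS5] at hρ
  | cut _ G H Γ Δ Λ Θ φ _ _ ih₁ ih₂ =>
    simp only [List.forall_mem_append, List.forall_mem_cons, Countermodel, Multiset.mem_add,
      Multiset.forall_mem_cons] at ih₁ ih₂ ⊢
    rintro ⟨hG, ⟨w, hw, hl, hr⟩, hH⟩
    by_cases hφ : M.sat w φ
    · exact ih₂ ⟨hG, ⟨w, hw, ⟨hφ, fun ψ h => hl ψ (.inr h)⟩, fun ψ h => hr ψ (.inr h)⟩, hH⟩
    · exact ih₁ ⟨hG, ⟨w, hw, fun ψ h => hl ψ (.inl h), hφ, fun ψ h => hr ψ (.inl h)⟩, hH⟩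
  | boxL G H Γ Δ Λ Θ φ _ ih =>
    simp only [List.forall_mem_append, List.forall_mem_cons, Countermodel,
      Multiset.forall_mem_cons, KModel.sat] at ih ⊢
    rintro ⟨hG, ⟨w, hw, ⟨hφ, hl⟩, hr⟩, ⟨v, hv, hl', hr'⟩, hH⟩
    exact ih ⟨hG, ⟨w, hw, hl, hr⟩, ⟨v, hv, ⟨hφ v (hclique w v hw hv), hl'⟩, hr'⟩, hH⟩
  | boxR G Γ Δ φ _ ih =>
    simp only [List.forall_mem_append, List.forall_mem_cons, Countermodel,
      Multiset.forall_mem_cons, KModel.sat, not_forall] at ih ⊢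
    rintro ⟨hG, ⟨w, hw, hl, ⟨v, hwv, hφ⟩, hr⟩, hnil⟩
    exact ih ⟨hG, ⟨w, hw, hl, hr⟩, ⟨v, hclosed w v hw hwv, by simp, by simpa using hφ⟩, hnil⟩
  | andR G H Γ Δ φ ψ _ _ ih₁ ih₂ =>
    simp only [List.forall_mem_append, List.forall_mem_cons, Countermodel,
      Multiset.forall_mem_cons, KModel.sat] at ih₁ ih₂ ⊢
    rintro ⟨hG, ⟨w, hw, hl, hφψ, hr⟩, hH⟩
    by_cases hφ : M.sat w φ
    · exact ih₂ ⟨hG, ⟨w, hw, hl, fun hψ => hφψ ⟨hφ, hψ⟩, hr⟩, hH⟩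
    · exact ih₁ ⟨hG, ⟨w, hw, hl, hφ, hr⟩, hH⟩
  | ax φ => simp [Countermodel]
  | ewr G _ ih => exact fun h => ih fun S hS => h S (by simp [hS])
  | ewl G _ ih => exact fun h => ih fun S hS => h S (by simp [hS])
  | ec _ G H S _ ih => exact fun h => ih fun T hT => h T (by simpa using hT)
  | ew _ G H _ ih => exact fun h => ih fun S hS => h S (by simp at hS ⊢; tauto)
  | ee _ G H S S' _ ih => exact fun h => ih fun T hT => h T (by simp at hT ⊢; tauto)
  | _ =>
    rename_i ih
    simp only [List.forall_mem_append, List.forall_mem_cons, Countermodel,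
      Multiset.forall_mem_cons, KModel.sat, not_not] at ih ⊢
    rintro ⟨hG, ⟨w, hw, hl, hr⟩, hH⟩
    exact ih ⟨hG, ⟨w, hw, by tauto, by tauto⟩, hH⟩

/-- Soundness of RS5: derivable hypersequents have no counter-example in any
Kripke model with reflexive, transitive and symmetric accessibility relation. -/
theorem RS5_soundness (H : Hyperseq) (hH : Deriv RS5 H) (M : KModel)
    (hrefl : Reflexive M.R) (htrans : Transitive M.R) (hsym : Symmetric M.R) :
    ¬ CounterExample M H := by
  rintro ⟨ws, hchain, hcm⟩
  have : IsTrans M.W M.R := ⟨fun _ _ _ => @htrans _ _ _⟩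
  have : Std.Symm M.R := ⟨fun _ _ h => hsym h⟩
  have hrel : ∀ a ∈ ws, ∀ b ∈ ws, M.R a b := fun a ha b hb =>
    (List.isChain_iff_pairwise.mp hchain).forall_of_forall (fun x _ => hrefl x) ha hb
  refine hH.not_forall_countermodel_of_clique M (fun w => ∃ a ∈ ws, M.R a w) ?_ ?_ ?_
  · rintro u v ⟨a, ha, hau⟩ ⟨b, hb, hbv⟩
    exact htrans (hsym hau) (htrans (hrel a ha b hb) hbv)
  · rintro u v ⟨a, ha, hau⟩ huv
    exact ⟨a, ha, htrans hau huv⟩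
  · intro S hS
    obtain ⟨i, hi, rfl⟩ := List.getElem_of_mem hS
    have hi' : i < ws.length := hcm.length_eq ▸ hi
    exact ⟨ws[i], ⟨ws[i], List.getElem_mem hi', hrefl _⟩, hcm.get hi hi'⟩
end

section
/- The external contraction rule EC preserves absence of counter-examples over reflexive models: if a Kripke model M with reflexive accessibility relation is a counter-example to the hypersequent G | Γ ⇒ Δ | H, then M is a counter-example to G | Γ ⇒ Δ | Γ ⇒ Δ | H. -/
/-- A list related pointwise to a concatenation splits accordingly. -/
theorem List.Forall₂.exists_of_append_left {α β : Type*} {r : α → β → Prop} {l₁ l₂ : List α}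
    {l : List β} (h : List.Forall₂ r (l₁ ++ l₂) l) :
    ∃ u v, List.Forall₂ r l₁ u ∧ List.Forall₂ r l₂ v ∧ l = u ++ v := by
  induction l₁ generalizing l with
  | nil => exact ⟨[], l, .nil, h, rfl⟩
  | cons a l₁ ih =>
    cases h with
    | cons hab ht =>
      obtain ⟨u, v, hu, hv, rfl⟩ := ih ht
      exact ⟨_ :: u, v, .cons hab hu, hv, rfl⟩

/-- EC preserves absence of counter-examples over reflexive models: a counter-example
to `G | Γ ⇒ Δ | H` is a counter-example to `G | Γ ⇒ Δ | Γ ⇒ Δ | H`. -/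
theorem EC_sound (M : KModel) (hrefl : Reflexive M.R) (G H : Hyperseq) (S : Seqt)
    (h : CounterExample M (G ++ S :: H)) :
    CounterExample M (G ++ S :: S :: H) := by
  obtain ⟨ws, hchain, hws⟩ := h
  obtain ⟨us, vs, hG, hSH, rfl⟩ := hws.exists_of_append_left
  cases hSH with
  | @cons _ w _ vs hS hH =>
    refine ⟨us ++ w :: w :: vs, ?_, List.rel_append hG (.cons hS (.cons hS hH))⟩
    have hsplit := List.isChain_split.1 hchain
    exact List.isChain_split.2 ⟨hsplit.1, List.isChain_cons_cons.2 ⟨hrefl w, hsplit.2⟩⟩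
end

section
/- The rule Drop preserves absence of counter-examples over serial models: if a Kripke model M with serial accessibility relation is a counter-example to the hypersequent G, then M is a counter-example to G | ⇒ (G followed by an empty component). -/
/-- Drop preserves absence of counter-examples over serial models: a counter-example
to `G` is a counter-example to `G | ⇒`. -/
theorem Drop_sound (M : KModel) (hser : ∀ w : M.W, ∃ v : M.W, M.R w v)
    (G : Hyperseq) (hne : G ≠ []) (h : CounterExample M G) :
    CounterExample M (G ++ [Seqt.empty]) := by
  obtain ⟨ws, hchain, hws⟩ := h
  have hnil : ws ≠ [] := by
    rintro rfl
    exact hne (List.forall₂_nil_right_iff.mp hws)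
  obtain ⟨v, hv⟩ := hser (ws.getLast hnil)
  refine ⟨ws ++ [v], List.IsChain.append hchain (List.isChain_singleton v) ?_,
    List.rel_append hws (.cons ⟨?_, ?_⟩ .nil)⟩
  · intro x hx y hy
    rw [List.getLast?_eq_getLast_of_ne_nil hnil] at hx
    simp only [Option.mem_def, Option.some.injEq, List.head?_cons] at hx hy
    subst hx hy
    exact hv
  · simp [Seqt.empty]
  · simp [Seqt.empty]
end

section
/- The external weakening rule EW preserves absence of counter-examples over transitive models: if a Kripke model M with transitive accessibility relation is a counter-example to the hypersequent G | Γ ⇒ Δ | ⇒ | Γ' ⇒ Δ' | H (with an empty component inserted between Γ ⇒ Δ and Γ' ⇒ Δ'), then M is a counter-example to G | Γ ⇒ Δ | Γ' ⇒ Δ' | H. -/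
/-- EW preserves absence of counter-examples over transitive models: a counter-example
to `G | Γ ⇒ Δ | ⇒ | Γ' ⇒ Δ' | H` is a counter-example to `G | Γ ⇒ Δ | Γ' ⇒ Δ' | H`. -/
theorem EW_sound (M : KModel) (htrans : Transitive M.R) (G H : Hyperseq) (S S' : Seqt)
    (h : CounterExample M (G ++ S :: Seqt.empty :: S' :: H)) :
    CounterExample M (G ++ S :: S' :: H) := by
  obtain ⟨ws, hc, hf⟩ := h
  obtain ⟨hG, hr⟩ : List.Forall₂ (fun S w => Countermodel M w S) G (ws.take G.length) ∧
      List.Forall₂ (fun S w => Countermodel M w S) (S :: Seqt.empty :: S' :: H)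
        (ws.drop G.length) := by
    simpa using And.intro (List.forall₂_take G.length hf) (List.forall₂_drop G.length hf)
  rw [← List.take_append_drop G.length ws] at hc
  generalize ws.take G.length = us at hG hc
  generalize ws.drop G.length = vs at hr hc
  obtain _ | ⟨hS, _ | ⟨_, _ | ⟨hS', hH⟩⟩⟩ := hr
  refine ⟨us ++ _ :: _ :: _, ?_, List.rel_append hG (.cons hS (.cons hS' hH))⟩
  obtain ⟨hus, hvs, hj⟩ := List.isChain_append.1 hc
  simp only [List.isChain_cons_cons] at hvs
  exact List.isChain_append.2 ⟨hus,
    List.isChain_cons_cons.2 ⟨htrans hvs.1 hvs.2.1, hvs.2.2⟩, by simpa using hj⟩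
end

section
/- The exchange rule EE preserves absence of counter-examples over reflexive, transitive, symmetric models: if a Kripke model M whose accessibility relation is transitive and symmetric is a counter-example to the hypersequent G | Γ' ⇒ Δ' | Γ ⇒ Δ | H (obtained by swapping the adjacent components Γ ⇒ Δ and Γ' ⇒ Δ'), then M is a counter-example to G | Γ ⇒ Δ | Γ' ⇒ Δ' | H. -/
/-- EE preserves absence of counter-examples over transitive and symmetric models:
a counter-example to `G | Γ' ⇒ Δ' | Γ ⇒ Δ | H` (the swapped hypersequent) is a
counter-example to `G | Γ ⇒ Δ | Γ' ⇒ Δ' | H`. -/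
theorem EE_sound (M : KModel) (htrans : Transitive M.R) (hsym : Symmetric M.R)
    (G H : Hyperseq) (S S' : Seqt)
    (h : CounterExample M (G ++ S' :: S :: H)) :
    CounterExample M (G ++ S :: S' :: H) := by
  obtain ⟨ws, hc, hf⟩ := h
  have : IsTrans M.W M.R := ⟨fun _ _ _ => @htrans _ _ _⟩
  have hg := List.forall₂_take G.length hf
  have hk := List.forall₂_drop G.length hf
  rw [List.take_left] at hg
  rw [List.drop_left] at hk
  rw [← List.take_append_drop G.length ws] at hc
  generalize ws.take G.length = g at hc hg
  generalize ws.drop G.length = k at hc hk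
  obtain _ | @⟨_, v', _, _, hv', _ | @⟨_, v, _, k, hv, hk⟩⟩ := hk
  refine ⟨g ++ v :: v' :: k, ?_, List.rel_append hg (.cons hv (.cons hv' hk))⟩
  have hp := List.isChain_iff_pairwise.mp hc
  exact List.isChain_iff_pairwise.mpr <|
    (((List.Perm.swap v v' k).append_left g).pairwise_iff (fun h => hsym h)).mp hp
end

section
/- If a labelled hypersequent H is unprovable in cut-free RK, then every σ-reduct of H (for any label σ) is unprovable in cut-free RK. -/
/-- Labels: finite sequences of natural numbers. -/
abbrev Label := List ℕ

/-- Labelled hypersequents: sequences of labelled sequents. -/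
abbrev LHyp := List (Label × Seqt)

/-- The successor order on labels: `RLab σ τ` iff `τ = σ.n` for some `n`. -/
def RLab (σ τ : Label) : Prop := ∃ n : ℕ, τ = σ ++ [n]

/-- A labelled hypersequent: nonempty, and its labels form a branch under
the successor order. -/
def IsLabelled (L : LHyp) : Prop :=
  L ≠ [] ∧ List.Chain' (fun a b => RLab a.1 b.1) L

/-- Cut-free RK: no cut, and none of the optional external structural rules. -/
def cfRK : RuleSet := {}

/-- A labelled hypersequent is provable iff its underlying hypersequent is derivable. -/
def LProvable (ρ : RuleSet) (L : LHyp) : Prop := Deriv ρ (L.map Prod.snd)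

/-- `comp L σ`: the rightmost `σ`-labelled component of `L`
(the empty sequent if there is none). -/
def comp (L : LHyp) (σ : Label) : Seqt :=
  (((L.reverse.find? (fun p => p.1 == σ)).map Prod.snd).getD Seqt.empty)

/-- The `σ`-reduct relation on labelled hypersequents, corresponding to the rules
¬L, ¬R, ∧L, ∧R and □L.  A reduction is applicable only if it adds new material
(otherwise the reduct is identical to the original hypersequent); for ∧R, the
reduct adds the left conjunct if the result is unprovable, otherwise the right. -/
inductive Reduct (ρ : RuleSet) (σ : Label) : LHyp → LHyp → Prop
  | negL (G G' : LHyp) (Γ Δ : Multiset MF) (φ : MF) (h : φ ∉ Δ) :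
      Reduct ρ σ (G ++ (σ, ⟨.neg φ ::ₘ Γ, Δ⟩) :: G')
                 (G ++ (σ, ⟨.neg φ ::ₘ Γ, φ ::ₘ Δ⟩) :: G')
  | negR (G G' : LHyp) (Γ Δ : Multiset MF) (φ : MF) (h : φ ∉ Γ) :
      Reduct ρ σ (G ++ (σ, ⟨Γ, .neg φ ::ₘ Δ⟩) :: G')
                 (G ++ (σ, ⟨φ ::ₘ Γ, .neg φ ::ₘ Δ⟩) :: G')
  | andL (G G' : LHyp) (Γ Δ : Multiset MF) (φ ψ : MF) (h : ¬ (φ ∈ Γ ∧ ψ ∈ Γ)) :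
      Reduct ρ σ (G ++ (σ, ⟨.conj φ ψ ::ₘ Γ, Δ⟩) :: G')
                 (G ++ (σ, ⟨φ ::ₘ ψ ::ₘ .conj φ ψ ::ₘ Γ, Δ⟩) :: G')
  | andR1 (G G' : LHyp) (Γ Δ : Multiset MF) (φ ψ : MF) (h : φ ∉ Δ ∧ ψ ∉ Δ)
      (hunp : ¬ LProvable ρ (G ++ (σ, ⟨Γ, φ ::ₘ .conj φ ψ ::ₘ Δ⟩) :: G')) :
      Reduct ρ σ (G ++ (σ, ⟨Γ, .conj φ ψ ::ₘ Δ⟩) :: G')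
                 (G ++ (σ, ⟨Γ, φ ::ₘ .conj φ ψ ::ₘ Δ⟩) :: G')
  | andR2 (G G' : LHyp) (Γ Δ : Multiset MF) (φ ψ : MF) (h : φ ∉ Δ ∧ ψ ∉ Δ)
      (hprov : LProvable ρ (G ++ (σ, ⟨Γ, φ ::ₘ .conj φ ψ ::ₘ Δ⟩) :: G')) :
      Reduct ρ σ (G ++ (σ, ⟨Γ, .conj φ ψ ::ₘ Δ⟩) :: G')
                 (G ++ (σ, ⟨Γ, ψ ::ₘ .conj φ ψ ::ₘ Δ⟩) :: G')
  | boxL (G G' : LHyp) (σ' : Label) (Γ' Δ' Γ Δ : Multiset MF) (φ : MF) (h : φ ∉ Γ) :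
      Reduct ρ σ (G ++ (σ', ⟨.box φ ::ₘ Γ', Δ'⟩) :: (σ, ⟨Γ, Δ⟩) :: G')
                 (G ++ (σ', ⟨.box φ ::ₘ Γ', Δ'⟩) :: (σ, ⟨φ ::ₘ Γ, Δ⟩) :: G')

/-- `L` is `σ`-reduced: it is identical to all of its `σ`-reducts. -/
def Reduced (ρ : RuleSet) (σ : Label) (L : LHyp) : Prop :=
  ∀ L', Reduct ρ σ L L' → L' = L

/-- `L` is fully reduced: `σ`-reduced for every label `σ`. -/
def FullyReduced (ρ : RuleSet) (L : LHyp) : Prop := ∀ σ, Reduced ρ σ L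

/-- One reduction step (at some label). -/
def ReductStep (ρ : RuleSet) (A B : LHyp) : Prop := ∃ σ, Reduct ρ σ A B

/-- `L'` is a full reduction of `L`: obtained from `L` by a finite sequence of
reductions, and fully reduced. -/
def IsFullReduction (ρ : RuleSet) (L L' : LHyp) : Prop :=
  Relation.ReflTransGen (ReductStep ρ) L L' ∧ FullyReduced ρ L'

/-- `S'` extends `S`: antecedent and succedent are multiset-contained. -/
def Seqt.Ext (S' S : Seqt) : Prop := S.ant ≤ S'.ant ∧ S.suc ≤ S'.suc

/-- `L'` extends `L`: for every label of `L`, the rightmost `σ`-component of `L'`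
extends that of `L`. -/
def LExtends (L' L : LHyp) : Prop :=
  ∀ σ ∈ L.map Prod.fst, Seqt.Ext (comp L' σ) (comp L σ)

/-- If a labelled hypersequent is unprovable in cut-free RK, so is every σ-reduct of it. -/
theorem reduct_unprovable (L L' : LHyp) (σ : Label) (hl : IsLabelled L)
    (hunp : ¬ LProvable cfRK L) (hred : Reduct cfRK σ L L') :
    ¬ LProvable cfRK L' := by
  intro hL'
  apply hunp
  cases hred <;> simp only [LProvable, List.map_append, List.map_cons] at *
  case negL => exact .cl _ _ _ _ _ (.negL _ _ _ _ _ hL')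
  case negR => exact .cr _ _ _ _ _ (.negR _ _ _ _ _ hL')
  case andL φ ψ _ =>
    refine .cl _ _ _ _ _ (.andL2 _ _ _ _ φ ψ ?_)
    rw [Multiset.cons_swap]
    refine .cl _ _ _ _ _ (.andL1 _ _ _ _ φ ψ ?_)
    rwa [Multiset.cons_swap _ ψ]
  case andR1 _ hφ => exact absurd hL' hφ
  case andR2 _ hφ => exact .cr _ _ _ _ _ (.andR _ _ _ _ _ _ hφ hL')
  case boxL => exact .cl _ _ _ _ _ (.boxL _ _ _ _ _ _ _ hL')
end

section
/- Every labelled hypersequent H that is unprovable in cut-free RK is extended by an unprovable, fully reduced labelled hypersequent Red(H) (its full reduction): there exists a fully reduced labelled hypersequent H' unprovable in cut-free RK such that for every label σ occurring in H, the σ-component of H' extends the σ-component of H. -/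
/-- `T` contains the immediate subformulas of each of its members. -/
def SubClosed (T : Finset MF) : Prop :=
  (∀ φ, .neg φ ∈ T → φ ∈ T) ∧ (∀ φ ψ, .conj φ ψ ∈ T → φ ∈ T ∧ ψ ∈ T) ∧
    ∀ φ, .box φ ∈ T → φ ∈ T

open Classical in
theorem SubClosed.union {S T : Finset MF} (hS : SubClosed S) (hT : SubClosed T) :
    SubClosed (S ∪ T) := by
  obtain ⟨h1, h2, h3⟩ := hS
  obtain ⟨k1, k2, k3⟩ := hT
  refine ⟨?_, ?_, ?_⟩ <;> simp only [Finset.mem_union] <;> grind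

open Classical in
theorem exists_subClosed_mem (φ : MF) : ∃ T, SubClosed T ∧ φ ∈ T := by
  induction φ with
  | atom n => exact ⟨{.atom n}, by simp [SubClosed], by simp⟩
  | neg φ ih =>
    obtain ⟨T, ⟨h1, h2, h3⟩, hm⟩ := ih
    refine ⟨insert (.neg φ) T, ⟨?_, ?_, ?_⟩, by simp⟩ <;> simp <;> grind
  | conj φ ψ ih1 ih2 =>
    obtain ⟨S, hS, hm⟩ := ih1
    obtain ⟨T, hT, hm'⟩ := ih2
    obtain ⟨h1, h2, h3⟩ := hS.union hT
    simp only [Finset.mem_union] at h1 h2 h3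
    refine ⟨insert (.conj φ ψ) (S ∪ T), ⟨?_, ?_, ?_⟩, by simp⟩ <;>
      simp only [Finset.mem_insert, Finset.mem_union] <;> grind
  | box φ ih =>
    obtain ⟨T, ⟨h1, h2, h3⟩, hm⟩ := ih
    refine ⟨insert (.box φ) T, ⟨?_, ?_, ?_⟩, by simp⟩ <;> simp <;> grind

open Classical in
theorem exists_subClosed_superset (s : Multiset MF) : ∃ T, SubClosed T ∧ ∀ φ ∈ s, φ ∈ T := by
  induction s using Multiset.induction with
  | empty => exact ⟨∅, by simp [SubClosed], by simp⟩
  | cons φ s ih =>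
    obtain ⟨T, hT, h⟩ := ih
    obtain ⟨S, hS, h'⟩ := exists_subClosed_mem φ
    exact ⟨S ∪ T, hS.union hT, by simp; grind⟩

/-- All formulas of the sequent lie in `T`. -/
def Seqt.Within (T : Finset MF) (S : Seqt) : Prop :=
  (∀ φ ∈ S.ant, φ ∈ T) ∧ ∀ φ ∈ S.suc, φ ∈ T

open Classical in
theorem exists_subClosed_within (L : LHyp) : ∃ T, SubClosed T ∧ ∀ p ∈ L, p.2.Within T := by
  induction L with
  | nil => exact ⟨∅, by simp [SubClosed], by simp⟩
  | cons p L ih =>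
    obtain ⟨T, hT, h⟩ := ih
    obtain ⟨S, hS, h'⟩ := exists_subClosed_superset (p.2.ant + p.2.suc)
    refine ⟨S ∪ T, hS.union hT, ?_⟩
    rintro q hq
    rcases List.mem_cons.1 hq with rfl | hq
    · exact ⟨fun φ hφ => Finset.mem_union_left _ (h' φ (Multiset.mem_add.2 (.inl hφ))),
        fun φ hφ => Finset.mem_union_left _ (h' φ (Multiset.mem_add.2 (.inr hφ)))⟩
    · exact ⟨fun φ hφ => Finset.mem_union_right _ ((h q hq).1 φ hφ),
        fun φ hφ => Finset.mem_union_right _ ((h q hq).2 φ hφ)⟩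

open Classical in
/-- The number of formulas of `T` absent from the antecedent, plus those absent from the
succedent. -/
noncomputable def Seqt.missing (T : Finset MF) (S : Seqt) : ℕ :=
  (T.filter (· ∉ S.ant)).card + (T.filter (· ∉ S.suc)).card

/-- The total number of missing formulas over all components. -/
noncomputable def missingSum (T : Finset MF) (L : LHyp) : ℕ :=
  (L.map fun p => p.2.missing T).sum

open Classical in
theorem card_filter_notMem_le {T : Finset MF} {s t : Multiset MF} (h : s ≤ t) :
    (T.filter (· ∉ t)).card ≤ (T.filter (· ∉ s)).card :=
  Finset.card_le_card <| Finset.monotone_filter_right _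
    fun _ _ hx hm => hx (Multiset.mem_of_le h hm)

open Classical in
theorem card_filter_notMem_lt {T : Finset MF} {s t : Multiset MF} (h : s ≤ t) {φ : MF}
    (hT : φ ∈ T) (hs : φ ∉ s) (ht : φ ∈ t) :
    (T.filter (· ∉ t)).card < (T.filter (· ∉ s)).card := by
  refine Finset.card_lt_card ((Finset.ssubset_iff_of_subset ?_).2 ⟨φ, by simp [*], by simp [*]⟩)
  exact Finset.monotone_filter_right _ fun _ _ hx hm => hx (Multiset.mem_of_le h hm)

open Classical in
theorem Seqt.Ext.missing_lt_of_ant {T : Finset MF} {S S' : Seqt} (h : S'.Ext S) {φ : MF}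
    (hT : φ ∈ T) (hs : φ ∉ S.ant) (hs' : φ ∈ S'.ant) : S'.missing T < S.missing T :=
  add_lt_add_of_lt_of_le (card_filter_notMem_lt h.1 hT hs hs') (card_filter_notMem_le h.2)

open Classical in
theorem Seqt.Ext.missing_lt_of_suc {T : Finset MF} {S S' : Seqt} (h : S'.Ext S) {φ : MF}
    (hT : φ ∈ T) (hs : φ ∉ S.suc) (hs' : φ ∈ S'.suc) : S'.missing T < S.missing T :=
  add_lt_add_of_le_of_lt (card_filter_notMem_le h.1) (card_filter_notMem_lt h.2 hT hs hs')

theorem MF.left_ne_conj (φ ψ : MF) : φ ≠ .conj φ ψ := fun h => by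
  have := congrArg sizeOf h
  simp only [MF.conj.sizeOf_spec] at this
  omega

theorem MF.right_ne_conj (φ ψ : MF) : ψ ≠ .conj φ ψ := fun h => by
  have := congrArg sizeOf h
  simp only [MF.conj.sizeOf_spec] at this
  omega

/-- A reduct changes a single component, which it strictly enlarges inside any finite
subformula-closed set containing all formulas of the hypersequent. -/
theorem Reduct.exists_replace {ρ : RuleSet} {σ : Label} {L L' : LHyp} (h : Reduct ρ σ L L')
    {T : Finset MF} (hT : SubClosed T) (hL : ∀ p ∈ L, p.2.Within T) :
    ∃ (G G' : LHyp) (S S' : Seqt), L = G ++ (σ, S) :: G' ∧ L' = G ++ (σ, S') :: G' ∧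
      S'.Ext S ∧ S'.Within T ∧ S'.missing T < S.missing T := by
  obtain ⟨hneg, hconj, hbox⟩ := hT
  cases h with
  | negL G G' Γ Δ φ h =>
    have hS : Seqt.Within T ⟨.neg φ ::ₘ Γ, Δ⟩ := hL (σ, _) (by simp)
    have hφ := hneg φ (hS.1 _ (by simp))
    have he : Seqt.Ext ⟨.neg φ ::ₘ Γ, φ ::ₘ Δ⟩ ⟨.neg φ ::ₘ Γ, Δ⟩ :=
      ⟨le_rfl, Multiset.le_cons_self _ _⟩
    refine ⟨G, G', _, _, rfl, rfl, he, ⟨hS.1, ?_⟩, he.missing_lt_of_suc hφ h (by simp)⟩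
    simpa using ⟨hφ, hS.2⟩
  | negR G G' Γ Δ φ h =>
    have hS : Seqt.Within T ⟨Γ, .neg φ ::ₘ Δ⟩ := hL (σ, _) (by simp)
    have hφ := hneg φ (hS.2 _ (by simp))
    have he : Seqt.Ext ⟨φ ::ₘ Γ, .neg φ ::ₘ Δ⟩ ⟨Γ, .neg φ ::ₘ Δ⟩ :=
      ⟨Multiset.le_cons_self _ _, le_rfl⟩
    refine ⟨G, G', _, _, rfl, rfl, he, ⟨?_, hS.2⟩, he.missing_lt_of_ant hφ h (by simp)⟩
    simpa using ⟨hφ, hS.1⟩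
  | andL G G' Γ Δ φ ψ h =>
    have hS : Seqt.Within T ⟨.conj φ ψ ::ₘ Γ, Δ⟩ := hL (σ, _) (by simp)
    obtain ⟨hφ, hψ⟩ := hconj φ ψ (hS.1 _ (by simp))
    have he : Seqt.Ext ⟨φ ::ₘ ψ ::ₘ .conj φ ψ ::ₘ Γ, Δ⟩ ⟨.conj φ ψ ::ₘ Γ, Δ⟩ :=
      ⟨(Multiset.le_cons_self _ _).trans (Multiset.le_cons_self _ _), le_rfl⟩
    refine ⟨G, G', _, _, rfl, rfl, he, ⟨?_, hS.2⟩, ?_⟩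
    · have := hS.1
      simp only [Multiset.mem_cons] at this ⊢
      grind
    · rcases not_and_or.1 h with h | h
      · exact he.missing_lt_of_ant hφ (by simp [h, MF.left_ne_conj]) (by simp)
      · exact he.missing_lt_of_ant hψ (by simp [h, MF.right_ne_conj]) (by simp)
  | andR1 G G' Γ Δ φ ψ h =>
    have hS : Seqt.Within T ⟨Γ, .conj φ ψ ::ₘ Δ⟩ := hL (σ, _) (by simp)
    obtain ⟨hφ, -⟩ := hconj φ ψ (hS.2 _ (by simp))
    have he : Seqt.Ext ⟨Γ, φ ::ₘ .conj φ ψ ::ₘ Δ⟩ ⟨Γ, .conj φ ψ ::ₘ Δ⟩ :=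
      ⟨le_rfl, Multiset.le_cons_self _ _⟩
    refine ⟨G, G', _, _, rfl, rfl, he, ⟨hS.1, ?_⟩,
      he.missing_lt_of_suc hφ (by simp [h, MF.left_ne_conj]) (by simp)⟩
    have := hS.2
    simp only [Multiset.mem_cons] at this ⊢
    grind
  | andR2 G G' Γ Δ φ ψ h =>
    have hS : Seqt.Within T ⟨Γ, .conj φ ψ ::ₘ Δ⟩ := hL (σ, _) (by simp)
    obtain ⟨-, hψ⟩ := hconj φ ψ (hS.2 _ (by simp))
    have he : Seqt.Ext ⟨Γ, ψ ::ₘ .conj φ ψ ::ₘ Δ⟩ ⟨Γ, .conj φ ψ ::ₘ Δ⟩ :=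
      ⟨le_rfl, Multiset.le_cons_self _ _⟩
    refine ⟨G, G', _, _, rfl, rfl, he, ⟨hS.1, ?_⟩,
      he.missing_lt_of_suc hψ (by simp [h, MF.right_ne_conj]) (by simp)⟩
    have := hS.2
    simp only [Multiset.mem_cons] at this ⊢
    grind
  | boxL G G' σ' Γ' Δ' Γ Δ φ h =>
    have hS' : Seqt.Within T ⟨.box φ ::ₘ Γ', Δ'⟩ := hL (σ', _) (by simp)
    have hS : Seqt.Within T ⟨Γ, Δ⟩ := hL (σ, _) (by simp)
    have hφ := hbox φ (hS'.1 _ (by simp))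
    have he : Seqt.Ext ⟨φ ::ₘ Γ, Δ⟩ ⟨Γ, Δ⟩ := ⟨Multiset.le_cons_self _ _, le_rfl⟩
    refine ⟨G ++ [(σ', ⟨.box φ ::ₘ Γ', Δ'⟩)], G', _, _, by simp, by simp, he, ⟨?_, hS.2⟩,
      he.missing_lt_of_ant hφ h (by simp)⟩
    simpa using ⟨hφ, hS.1⟩

/-- Reductions preserve unprovability. -/
theorem Reduct.not_lProvable {ρ : RuleSet} {σ : Label} {L L' : LHyp} (h : Reduct ρ σ L L')
    (hL : ¬ LProvable ρ L) : ¬ LProvable ρ L' := by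
  intro hp
  cases h with
  | negL G G' Γ Δ φ h =>
    refine hL ?_
    simp only [LProvable, List.map_append, List.map_cons] at hp ⊢
    exact .cl _ _ _ _ _ (.negL _ _ _ _ _ hp)
  | negR G G' Γ Δ φ h =>
    refine hL ?_
    simp only [LProvable, List.map_append, List.map_cons] at hp ⊢
    exact .cr _ _ _ _ _ (.negR _ _ _ _ _ hp)
  | andL G G' Γ Δ φ ψ h =>
    refine hL ?_
    simp only [LProvable, List.map_append, List.map_cons] at hp ⊢
    have h1 := Deriv.andL1 _ _ _ _ _ ψ hp
    rw [Multiset.cons_swap] at h1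
    exact .cl _ _ _ _ _ (.cl _ _ _ _ _ (.andL2 _ _ _ _ φ ψ h1))
  | andR1 G G' Γ Δ φ ψ h hunp => exact hunp hp
  | andR2 G G' Γ Δ φ ψ h hprov =>
    refine hL ?_
    simp only [LProvable, List.map_append, List.map_cons] at hp hprov ⊢
    exact .cr _ _ _ _ _ (.andR _ _ _ _ _ _ hprov hp)
  | boxL G G' σ' Γ' Δ' Γ Δ φ h =>
    refine hL ?_
    simp only [LProvable, List.map_append, List.map_cons] at hp ⊢
    exact .cl _ _ _ _ _ (.boxL _ _ _ _ _ _ _ hp)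

/-- Componentwise extension with equal labels. -/
def PointwiseExt (L' L : LHyp) : Prop :=
  List.Forall₂ (fun p q : Label × Seqt => p.1 = q.1 ∧ p.2.Ext q.2) L' L

theorem Seqt.Ext.refl (S : Seqt) : S.Ext S := ⟨le_rfl, le_rfl⟩

theorem Seqt.Ext.trans {S S' S'' : Seqt} (h : S''.Ext S') (h' : S'.Ext S) : S''.Ext S :=
  ⟨h'.1.trans h.1, h'.2.trans h.2⟩

theorem PointwiseExt.refl (L : LHyp) : PointwiseExt L L :=
  List.forall₂_same.2 fun _ _ => ⟨rfl, .refl _⟩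

theorem PointwiseExt.trans {L L' L'' : LHyp} (h : PointwiseExt L'' L')
    (h' : PointwiseExt L' L) : PointwiseExt L'' L := by
  induction h generalizing L with
  | nil => exact h'
  | cons hp _ ih =>
    cases h' with
    | cons hq ht => exact .cons ⟨hp.1.trans hq.1, hp.2.trans hq.2⟩ (ih ht)

theorem PointwiseExt.replace {σ : Label} {S S' : Seqt} (h : S'.Ext S) (G G' : LHyp) :
    PointwiseExt (G ++ (σ, S') :: G') (G ++ (σ, S) :: G') :=
  List.rel_append (PointwiseExt.refl G) (.cons ⟨rfl, h⟩ (PointwiseExt.refl G'))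

theorem PointwiseExt.map_fst_eq {L L' : LHyp} (h : PointwiseExt L' L) :
    L'.map Prod.fst = L.map Prod.fst := by
  induction h with
  | nil => rfl
  | cons hp _ ih => simp [hp.1, ih]

theorem PointwiseExt.isLabelled {L L' : LHyp} (h : PointwiseExt L' L) (hL : IsLabelled L) :
    IsLabelled L' := by
  obtain ⟨hne, hc⟩ := hL
  have key : ∀ M : LHyp, List.IsChain (fun a b => RLab a.1 b.1) M ↔
      List.IsChain RLab (M.map Prod.fst) := fun M => (List.isChain_map _).symm
  refine ⟨?_, (key L').2 (h.map_fst_eq ▸ (key L).1 hc)⟩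
  rintro rfl
  cases h
  exact hne rfl

theorem PointwiseExt.lExtends {L L' : LHyp} (h : PointwiseExt L' L) : LExtends L' L := by
  intro σ _
  have hr : PointwiseExt L'.reverse L.reverse := List.rel_reverse h
  unfold comp
  generalize L'.reverse = M' at hr
  generalize L.reverse = M at hr
  induction hr with
  | nil => exact .refl _
  | @cons p q _ _ hp _ ih =>
    rw [List.find?_cons, List.find?_cons, hp.1]
    cases q.1 == σ
    · exact ih
    · exact hp.2

/-- Every labelled hypersequent unprovable in cut-free RK is extended by an
unprovable, fully reduced labelled hypersequent (its full reduction). -/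
theorem full_reduction_exists (L : LHyp) (hl : IsLabelled L)
    (hunp : ¬ LProvable cfRK L) :
    ∃ L' : LHyp, IsFullReduction cfRK L L' ∧ IsLabelled L' ∧
      ¬ LProvable cfRK L' ∧ LExtends L' L := by
  obtain ⟨T, hT, hL⟩ := exists_subClosed_within L
  suffices ∃ L', IsFullReduction cfRK L L' ∧ ¬ LProvable cfRK L' ∧ PointwiseExt L' L by
    obtain ⟨L', hr, hu, he⟩ := this
    exact ⟨L', hr, he.isLabelled hl, hu, he.lExtends⟩
  clear hl
  induction hn : missingSum T L using Nat.strong_induction_on generalizing L with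
  | _ n ih =>
    by_cases hstep : ∃ M, ReductStep cfRK L M
    · obtain ⟨M, σ, hM⟩ := hstep
      have hMu := hM.not_lProvable hunp
      have hLM : ReductStep cfRK L M := ⟨σ, hM⟩
      obtain ⟨G, G', S, S', rfl, rfl, he, hw, hlt⟩ := hM.exists_replace hT hL
      obtain ⟨L', ⟨hr, hf⟩, hu, hx⟩ := ih _
        (by rw [← hn]; simpa [missingSum] using hlt) _ hMu
        (fun p hp => by
          simp only [List.mem_append, List.mem_cons] at hp hL
          rcases hp with hp | rfl | hp
          · exact hL p (.inl hp)
          · exact hw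
          · exact hL p (.inr (.inr hp))) rfl
      exact ⟨L', ⟨.head hLM hr, hf⟩, hu, hx.trans (.replace he G G')⟩
    · exact ⟨L, ⟨.refl, fun σ M hM => (hstep ⟨M, σ, hM⟩).elim⟩, hunp, .refl L⟩
end

section
/- Subformula properties of full reductions: let H = Red(H') be the full reduction of an unprovable labelled hypersequent H', with Γ(σ) and Δ(σ) the antecedent and succedent of H(σ). Then: (1) if ¬φ ∈ Γ(σ) then φ ∈ Δ(σ); (2) if ¬φ ∈ Δ(σ) then φ ∈ Γ(σ); (3) if φ∧ψ ∈ Γ(σ) then φ ∈ Γ(σ) and ψ ∈ Γ(σ); (4) if φ∧ψ ∈ Δ(σ) then φ ∈ Δ(σ) or ψ ∈ Δ(σ); (5) if □φ ∈ Γ(σ'), Rσ'σ, and σ occurs in H, then φ ∈ Γ(σ). -/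
theorem multiset_cons_ne_self {α : Type*} (a : α) (s : Multiset α) : a ::ₘ s ≠ s :=
  (Multiset.lt_cons_self s a).ne'

/-- A label occurring in `L` labels its rightmost component `comp L σ` there. -/
theorem comp_mem_of_label_mem {L : LHyp} {σ : Label} (h : σ ∈ L.map Prod.fst) :
    (σ, comp L σ) ∈ L := by
  unfold comp
  cases hf : L.reverse.find? (fun p => p.1 == σ) with
  | none =>
    obtain ⟨p, hp, rfl⟩ := List.mem_map.1 h
    simpa using List.find?_eq_none.1 hf p (List.mem_reverse.2 hp)
  | some p =>
    have hm := List.mem_reverse.1 (List.mem_of_find?_eq_some hf)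
    have hl : p.1 = σ := by simpa using List.find?_some hf
    subst hl
    exact hm

/-- A component of a label that does not occur is empty. -/
theorem comp_eq_empty {L : LHyp} {σ : Label} (h : σ ∉ L.map Prod.fst) :
    comp L σ = Seqt.empty := by
  unfold comp
  cases hf : L.reverse.find? (fun p => p.1 == σ) with
  | none => rfl
  | some p =>
    have hm := List.mem_reverse.1 (List.mem_of_find?_eq_some hf)
    have hl : p.1 = σ := by simpa using List.find?_some hf
    exact absurd (hl ▸ List.mem_map_of_mem hm) h

theorem label_mem_of_mem_ant {L : LHyp} {σ : Label} {φ : MF} (h : φ ∈ (comp L σ).ant) :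
    σ ∈ L.map Prod.fst := by
  by_contra hn
  simp [comp_eq_empty hn, Seqt.empty] at h

theorem label_mem_of_mem_suc {L : LHyp} {σ : Label} {φ : MF} (h : φ ∈ (comp L σ).suc) :
    σ ∈ L.map Prod.fst := by
  by_contra hn
  simp [comp_eq_empty hn, Seqt.empty] at h

theorem IsLabelled.pairwise_length {L : LHyp} (hl : IsLabelled L) :
    L.Pairwise (fun a b => a.1.length < b.1.length) := by
  have hc := hl.2
  have : IsTrans (Label × Seqt) (fun a b => a.1.length < b.1.length) :=
    ⟨fun _ _ _ => lt_trans⟩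
  refine List.isChain_iff_pairwise.1 (List.IsChain.imp ?_ hc)
  rintro a b ⟨n, hn⟩
  simp [hn]

/-- Components whose labels are related by the successor order are adjacent. -/
theorem IsLabelled.adjacent {L : LHyp} (hl : IsLabelled L) {σ' σ : Label} {S' S : Seqt}
    (h' : (σ', S') ∈ L) (h : (σ, S) ∈ L) (hR : RLab σ' σ) :
    ∃ G G' : LHyp, L = G ++ (σ', S') :: (σ, S) :: G' := by
  have hp := hl.pairwise_length
  obtain ⟨n, rfl⟩ := hR
  obtain ⟨A, B, rfl⟩ := List.append_of_mem h'
  refine ⟨A, ?_⟩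
  cases B with
  | nil =>
    simp only [List.pairwise_append, List.mem_append, List.mem_cons] at hp h
    rcases h with h | h | h
    · have := hp.2.2 _ h _ (Or.inl rfl)
      simp at this
    · simp at h
    · simp at h
  | cons b B =>
    simp only [List.pairwise_append, List.pairwise_cons, List.mem_append, List.mem_cons] at hp h
    rcases h with h | h | h | h
    · have := hp.2.2 _ h _ (Or.inl rfl)
      simp at this
    · simp at h
    · exact ⟨B, by rw [h]⟩
    · have h1 := hp.2.1.1 b (Or.inl rfl)
      have h2 := hp.2.1.2.1 _ h
      simp at h1 h2
      omega

/-- Subformula properties of full reductions: if `L` is an unprovable, fully reduced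
labelled hypersequent (the full reduction of an unprovable labelled hypersequent),
with `Γ(σ)`/`Δ(σ)` the antecedent/succedent of its rightmost `σ`-component, then
(1) ¬φ ∈ Γ(σ) implies φ ∈ Δ(σ); (2) ¬φ ∈ Δ(σ) implies φ ∈ Γ(σ);
(3) φ∧ψ ∈ Γ(σ) implies φ, ψ ∈ Γ(σ); (4) φ∧ψ ∈ Δ(σ) implies φ ∈ Δ(σ) or ψ ∈ Δ(σ);
(5) □φ ∈ Γ(σ'), Rσ'σ and σ occurring in `L` imply φ ∈ Γ(σ). -/
theorem red_subformula (L : LHyp) (hl : IsLabelled L)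
    (hunp : ¬ LProvable cfRK L) (hred : FullyReduced cfRK L) :
    (∀ (σ : Label) (φ : MF), MF.neg φ ∈ (comp L σ).ant → φ ∈ (comp L σ).suc) ∧
    (∀ (σ : Label) (φ : MF), MF.neg φ ∈ (comp L σ).suc → φ ∈ (comp L σ).ant) ∧
    (∀ (σ : Label) (φ ψ : MF), MF.conj φ ψ ∈ (comp L σ).ant →
      φ ∈ (comp L σ).ant ∧ ψ ∈ (comp L σ).ant) ∧
    (∀ (σ : Label) (φ ψ : MF), MF.conj φ ψ ∈ (comp L σ).suc →
      φ ∈ (comp L σ).suc ∨ ψ ∈ (comp L σ).suc) ∧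
    (∀ (σ' σ : Label) (φ : MF), MF.box φ ∈ (comp L σ').ant → RLab σ' σ →
      σ ∈ L.map Prod.fst → φ ∈ (comp L σ).ant) := by
  refine ⟨?_, ?_, ?_, ?_, ?_⟩
  · intro σ φ h
    have hm := comp_mem_of_label_mem (label_mem_of_mem_ant h)
    generalize comp L σ = S at *
    obtain ⟨Γ, Δ⟩ := S
    obtain ⟨G, G', rfl⟩ := List.append_of_mem hm
    obtain ⟨Γ, rfl⟩ := Multiset.exists_cons_of_mem h
    by_contra hn
    simpa [multiset_cons_ne_self] using hred σ _ (.negL G G' Γ Δ φ hn)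
  · intro σ φ h
    have hm := comp_mem_of_label_mem (label_mem_of_mem_suc h)
    generalize comp L σ = S at *
    obtain ⟨Γ, Δ⟩ := S
    obtain ⟨G, G', rfl⟩ := List.append_of_mem hm
    obtain ⟨Δ, rfl⟩ := Multiset.exists_cons_of_mem h
    by_contra hn
    simpa [multiset_cons_ne_self] using hred σ _ (.negR G G' Γ Δ φ hn)
  · intro σ φ ψ h
    have hm := comp_mem_of_label_mem (label_mem_of_mem_ant h)
    generalize comp L σ = S at *
    obtain ⟨Γ, Δ⟩ := S
    obtain ⟨G, G', rfl⟩ := List.append_of_mem hm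
    obtain ⟨Γ, rfl⟩ := Multiset.exists_cons_of_mem h
    by_contra hn
    have he := hred σ _ (.andL G G' Γ Δ φ ψ fun hh =>
      hn ⟨Multiset.mem_cons_of_mem hh.1, Multiset.mem_cons_of_mem hh.2⟩)
    simp only [List.append_cancel_left_eq, List.cons.injEq, Prod.mk.injEq, Seqt.mk.injEq,
      and_true, true_and] at he
    have hc := congrArg Multiset.card he
    simp at hc
    omega
  · intro σ φ ψ h
    have hm := comp_mem_of_label_mem (label_mem_of_mem_suc h)
    generalize comp L σ = S at *
    obtain ⟨Γ, Δ⟩ := S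
    obtain ⟨G, G', rfl⟩ := List.append_of_mem hm
    obtain ⟨Δ, rfl⟩ := Multiset.exists_cons_of_mem h
    by_contra hn
    have hΔ : φ ∉ Δ ∧ ψ ∉ Δ :=
      ⟨fun hh => hn (Or.inl (Multiset.mem_cons_of_mem hh)),
        fun hh => hn (Or.inr (Multiset.mem_cons_of_mem hh))⟩
    by_cases hp : LProvable cfRK (G ++ (σ, ⟨Γ, φ ::ₘ .conj φ ψ ::ₘ Δ⟩) :: G')
    · simpa [multiset_cons_ne_self] using hred σ _ (.andR2 G G' Γ Δ φ ψ hΔ hp)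
    · simpa [multiset_cons_ne_self] using hred σ _ (.andR1 G G' Γ Δ φ ψ hΔ hp)
  · intro σ' σ φ h hR hσ
    have hm' := comp_mem_of_label_mem (label_mem_of_mem_ant h)
    have hm := comp_mem_of_label_mem hσ
    obtain ⟨G, G', hL⟩ := hl.adjacent hm' hm hR
    generalize comp L σ' = S' at *
    generalize comp L σ = S at *
    obtain ⟨Γ', Δ'⟩ := S'
    obtain ⟨Γ, Δ⟩ := S
    obtain ⟨Γ', rfl⟩ := Multiset.exists_cons_of_mem h
    subst hL
    by_contra hn
    simpa [multiset_cons_ne_self] using hred σ _ (.boxL G G' σ' Γ' Δ' Γ Δ φ hn)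
end

section
/- The σ.n-ψ-successor of an unprovable, fully reduced labelled hypersequent is unprovable: if H = G | Γ ⇒[σ] Δ is unprovable in cut-free RK, fully reduced, □ψ ∈ Δ, and Succ is the full reduction of G | Γ ⇒[σ] Δ | ⇒[σ.n] ψ, then Succ is unprovable in cut-free RK. -/
/-- Each reduction step is backed by the rules of the calculus: a proof of a reduct yields a
proof of the original labelled hypersequent. -/
theorem LProvable.of_reduct {ρ : RuleSet} {σ : Label} {A B : LHyp} (h : Reduct ρ σ A B)
    (hB : LProvable ρ B) : LProvable ρ A := by
  cases h with
  | negL G G' Γ Δ φ _ =>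
    simp only [LProvable, List.map_append, List.map_cons] at hB ⊢
    exact .cl _ _ _ _ _ (.negL _ _ _ _ _ hB)
  | negR G G' Γ Δ φ _ =>
    simp only [LProvable, List.map_append, List.map_cons] at hB ⊢
    exact .cr _ _ _ _ _ (.negR _ _ _ _ _ hB)
  | andL G G' Γ Δ φ ψ _ =>
    simp only [LProvable, List.map_append, List.map_cons] at hB ⊢
    have h₁ := Deriv.andL1 _ _ _ _ φ ψ hB
    rw [Multiset.cons_swap] at h₁
    have h₂ := Deriv.andL2 _ _ _ _ φ ψ h₁
    exact .cl _ _ _ _ _ (.cl _ _ _ _ _ h₂)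
  | andR1 G G' Γ Δ φ ψ _ hunp => exact absurd hB hunp
  | andR2 G G' Γ Δ φ ψ _ hprov =>
    simp only [LProvable, List.map_append, List.map_cons] at hB hprov ⊢
    exact .cr _ _ _ _ _ (.andR _ _ _ _ _ _ hprov hB)
  | boxL G G' σ' Γ' Δ' Γ Δ φ _ =>
    simp only [LProvable, List.map_append, List.map_cons] at hB ⊢
    exact .cl _ _ _ _ _ (.boxL _ _ _ _ _ _ _ hB)

/-- Provability is reflected along finite sequences of reductions. -/
theorem LProvable.of_reflTransGen {ρ : RuleSet} {A B : LHyp}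
    (h : Relation.ReflTransGen (ReductStep ρ) A B) (hB : LProvable ρ B) : LProvable ρ A := by
  induction h with
  | refl => exact hB
  | tail _ hstep ih =>
    obtain ⟨σ, hσ⟩ := hstep
    exact ih (hB.of_reduct hσ)

/-- If `□ψ` occurs in the succedent of the last component, appending the component `⇒ ψ`
reflects provability. -/
theorem Deriv.of_append_box_mem {ρ : RuleSet} {G : Hyperseq} {Γ Δ : Multiset MF} {ψ : MF}
    (hbox : MF.box ψ ∈ Δ) (h : Deriv ρ (G ++ [⟨Γ, Δ⟩, ⟨0, {ψ}⟩])) :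
    Deriv ρ (G ++ [⟨Γ, Δ⟩]) := by
  obtain ⟨Θ, rfl⟩ := Multiset.exists_cons_of_mem hbox
  exact .cr _ _ _ _ _ (.boxR _ _ _ _ h)

/-- The σ.n-ψ-successor of an unprovable, fully reduced labelled hypersequent is
unprovable: if `G | Γ ⇒[σ] Δ` is unprovable in cut-free RK and fully reduced,
`□ψ ∈ Δ`, and `Succ` is a full reduction of `G | Γ ⇒[σ] Δ | ⇒[σ.n] ψ`, then
`Succ` is unprovable in cut-free RK. -/
theorem successor_unprovable (G : LHyp) (σ : Label) (Γ Δ : Multiset MF) (ψ : MF)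
    (n : ℕ) (Succ : LHyp)
    (hl : IsLabelled (G ++ [(σ, ⟨Γ, Δ⟩)]))
    (hunp : ¬ LProvable cfRK (G ++ [(σ, ⟨Γ, Δ⟩)]))
    (hred : FullyReduced cfRK (G ++ [(σ, ⟨Γ, Δ⟩)]))
    (hbox : MF.box ψ ∈ Δ)
    (hsucc : IsFullReduction cfRK
      (G ++ [(σ, ⟨Γ, Δ⟩), (σ ++ [n], ⟨0, {ψ}⟩)]) Succ) :
    ¬ LProvable cfRK Succ := by
  intro hprov
  have h := hprov.of_reflTransGen hsucc.1
  simp only [LProvable, List.map_append, List.map_cons, List.map_nil] at h hunp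
  exact hunp (h.of_append_box_mem hbox)
end

section
/- Passing to successors does not change earlier components: if H' is a σ.n-ψ-successor of the fully reduced labelled hypersequent H (whose rightmost component is labelled σ), and τ is a label with R*τσ (τ is σ or a predecessor of σ in the reflexive-transitive closure of the successor order), then H(τ) = H'(τ). -/
/-- A reduct always contains new material. -/
theorem Reduct.ne {ρ : RuleSet} {σ : Label} {L L' : LHyp} (h : Reduct ρ σ L L') : L' ≠ L := by
  intro e
  cases h <;>
    simp only [List.append_cancel_left_eq, List.cons.injEq, Prod.mk.injEq, Seqt.mk.injEq,
      true_and, and_true] at e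
  all_goals
    have hcard := congrArg Multiset.card e
    simp only [Multiset.card_cons] at hcard
    omega

theorem FullyReduced.not_reduct {ρ : RuleSet} {L : LHyp} (hL : FullyReduced ρ L)
    {σ : Label} {L' : LHyp} : ¬ Reduct ρ σ L L' :=
  fun h => h.ne (hL σ L' h)

/-- If a final component is appended to a fully reduced labelled hypersequent, then only this
component can be changed by a reduction. -/
theorem Reduct.eq_append_singleton {ρ : RuleSet} {σ : Label} {A L L' : LHyp}
    (hA : FullyReduced ρ A) (h : Reduct ρ σ L L') {μ : Label} {S : Seqt}
    (hL : L = A ++ [(μ, S)]) : ∃ S', L' = A ++ [(μ, S')] := by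
  have split : ∀ {G G' : LHyp} {p : Label × Seqt}, G ++ p :: G' = A ++ [(μ, S)] →
      (A = G ∧ p = (μ, S) ∧ G' = []) ∨ ∃ G'', A = G ++ p :: G'' := by
    intro G G' p e
    rcases List.eq_nil_or_concat G' with rfl | ⟨G'', q, rfl⟩
    · obtain ⟨h₁, h₂⟩ := List.append_inj' e rfl
      exact .inl ⟨h₁.symm, by simpa using h₂, rfl⟩
    · rw [List.concat_eq_append, ← List.cons_append, ← List.append_assoc] at e
      exact .inr ⟨G'', (List.append_inj' e rfl).1.symm⟩
  cases h with
  | negL G G' Γ Δ φ h =>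
    rcases split hL with ⟨rfl, hp, rfl⟩ | ⟨G'', rfl⟩
    · cases hp; exact ⟨_, rfl⟩
    · exact (hA.not_reduct (.negL G G'' Γ Δ φ h)).elim
  | negR G G' Γ Δ φ h =>
    rcases split hL with ⟨rfl, hp, rfl⟩ | ⟨G'', rfl⟩
    · cases hp; exact ⟨_, rfl⟩
    · exact (hA.not_reduct (.negR G G'' Γ Δ φ h)).elim
  | andL G G' Γ Δ φ ψ h =>
    rcases split hL with ⟨rfl, hp, rfl⟩ | ⟨G'', rfl⟩
    · cases hp; exact ⟨_, rfl⟩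
    · exact (hA.not_reduct (.andL G G'' Γ Δ φ ψ h)).elim
  | andR1 G G' Γ Δ φ ψ h _ | andR2 G G' Γ Δ φ ψ h _ =>
    rcases split hL with ⟨rfl, hp, rfl⟩ | ⟨G'', rfl⟩
    · cases hp; exact ⟨_, rfl⟩
    · by_cases hprov : LProvable ρ (G ++ (σ, ⟨Γ, φ ::ₘ .conj φ ψ ::ₘ Δ⟩) :: G'')
      · exact (hA.not_reduct (.andR2 G G'' Γ Δ φ ψ h hprov)).elim
      · exact (hA.not_reduct (.andR1 G G'' Γ Δ φ ψ h hprov)).elim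
  | boxL G G' σ' Γ' Δ' Γ Δ φ h =>
    rw [List.append_cons] at hL
    rcases split hL with ⟨rfl, hp, rfl⟩ | ⟨G'', rfl⟩
    · cases hp; exact ⟨⟨φ ::ₘ Γ, Δ⟩, by simp⟩
    · rw [← List.append_cons] at hA
      exact (hA.not_reduct (.boxL G G'' σ' Γ' Δ' Γ Δ φ h)).elim

theorem reflTransGen_reductStep_eq_append_singleton {ρ : RuleSet} {A L' : LHyp}
    (hA : FullyReduced ρ A) {μ : Label} {S : Seqt}
    (h : Relation.ReflTransGen (ReductStep ρ) (A ++ [(μ, S)]) L') :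
    ∃ S', L' = A ++ [(μ, S')] := by
  induction h with
  | refl => exact ⟨S, rfl⟩
  | tail _ hstep ih =>
    obtain ⟨_, hS⟩ := ih
    obtain ⟨_, hr⟩ := hstep
    exact hr.eq_append_singleton hA hS

theorem comp_append_singleton_of_ne (A : LHyp) {μ τ : Label} (S : Seqt) (h : μ ≠ τ) :
    comp (A ++ [(μ, S)]) τ = comp A τ := by
  simp [comp, h]

theorem length_le_of_reflTransGen_rLab {τ σ : Label} (h : Relation.ReflTransGen RLab τ σ) :
    τ.length ≤ σ.length := by
  induction h with
  | refl => exact le_rfl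
  | tail _ hstep ih =>
    obtain ⟨n, rfl⟩ := hstep
    simpa using ih.trans (Nat.le_succ _)

/-- Passing to successors does not change earlier components: if `L'` is a
σ.n-ψ-successor of the unprovable, fully reduced labelled hypersequent
`G | Γ ⇒[σ] Δ` (whose rightmost component is labelled σ), and `R* τ σ`, then the
rightmost τ-components of the original hypersequent and of `L'` coincide. -/
theorem successor_unchanged (G : LHyp) (σ : Label) (Γ Δ : Multiset MF) (ψ : MF)
    (n : ℕ) (L' : LHyp)
    (hl : IsLabelled (G ++ [(σ, ⟨Γ, Δ⟩)]))
    (hunp : ¬ LProvable cfRK (G ++ [(σ, ⟨Γ, Δ⟩)]))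
    (hred : FullyReduced cfRK (G ++ [(σ, ⟨Γ, Δ⟩)]))
    (hbox : MF.box ψ ∈ Δ)
    (hsucc : IsFullReduction cfRK
      (G ++ [(σ, ⟨Γ, Δ⟩), (σ ++ [n], ⟨0, {ψ}⟩)]) L')
    (τ : Label) (hτ : Relation.ReflTransGen RLab τ σ) :
    comp (G ++ [(σ, ⟨Γ, Δ⟩)]) τ = comp L' τ := by
  have hne : σ ++ [n] ≠ τ := by
    rintro rfl
    simpa using length_le_of_reflTransGen_rLab hτ
  rw [List.append_cons] at hsucc
  obtain ⟨S, rfl⟩ := reflTransGen_reductStep_eq_append_singleton hred hsucc.1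
  exact (comp_append_singleton_of_ne _ S hne).symm
end
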